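/- Let ℓ > 0 and μ ∈ ℝ, set τ := 2πi/ℓ, assume θ₃(μ;τ) ≠ 0, and set z_μ := (1/2 − μ)·ℓ + πi. Then for all z₁, z₂, z₃ ∈ ℂ with z_j − z_k ∉ Λ_ℓ for all j ≠ k, one has f_μ(z₂−z₁)·f_μ(z₃−z₂)·f_μ(z₁−z₃) + f_μ(z₁−z₂)·f_μ(z₂−z₃)·f_μ(z₃−z₁) = i·(2/π)³·℘′(z_μ;Λ_ℓ). In particular, the left-hand side does not depend on z₁, z₂, z₃. -/

import Mathlib

open Complex

noncomputable section

/-- Jacobi theta function `θ₁(w;τ)` with nome `q = exp(iπτ)`. -/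
def theta1 (τ w : ℂ) : ℂ :=
  -Complex.I * ∑' n : ℤ, (-1 : ℂ) ^ n *
    Complex.exp (Real.pi * Complex.I * τ * ((n : ℂ) + 1 / 2) ^ 2) *
    Complex.exp ((2 * (n : ℂ) + 1) * Real.pi * Complex.I * w)

/-- Jacobi theta function `θ₃(w;τ)` with nome `q = exp(iπτ)`. -/
def theta3 (τ w : ℂ) : ℂ :=
  ∑' n : ℤ, Complex.exp (Real.pi * Complex.I * τ * (n : ℂ) ^ 2) *
    Complex.exp (2 * Real.pi * Complex.I * (n : ℂ) * w)

/-- The modulus `τ = 2πi/ℓ`. -/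
def tau (ℓ : ℝ) : ℂ := 2 * Real.pi * Complex.I / (ℓ : ℂ)

/-- The function `g_μ(w) = (2/(πi))·θ₁′(0;τ)·θ₃(w+μ;τ)/(θ₃(μ;τ)·θ₁(w;τ))` with `τ = 2πi/ℓ`. -/
def gmu (ℓ μ : ℝ) (w : ℂ) : ℂ :=
  2 / (Real.pi * Complex.I) * deriv (theta1 (tau ℓ)) 0 * theta3 (tau ℓ) (w + (μ : ℂ)) /
    (theta3 (tau ℓ) (μ : ℂ) * theta1 (tau ℓ) w)

/-- The function `f_μ(z) = ℓ⁻¹ g_μ(z/ℓ)`. -/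
def fmu (ℓ μ : ℝ) (z : ℂ) : ℂ := (ℓ : ℂ)⁻¹ * gmu ℓ μ (z / (ℓ : ℂ))

/-- The lattice `{m ω₁ + n ω₂ : m, n ∈ ℤ}`. -/
def lat (ω₁ ω₂ : ℂ) : Set ℂ := {z : ℂ | ∃ m n : ℤ, z = (m : ℂ) * ω₁ + (n : ℂ) * ω₂}

/-- The Weierstrass `℘`-function for the lattice spanned by `ω₁, ω₂`:
`℘(z) = z⁻² + ∑_{ω ∈ Λ∖{0}} ((z−ω)⁻² − ω⁻²)`. -/
def wp (ω₁ ω₂ : ℂ) (z : ℂ) : ℂ :=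
  1 / z ^ 2 + ∑' p : {p : ℤ × ℤ // p ≠ 0},
    (1 / (z - ((p.1.1 : ℂ) * ω₁ + (p.1.2 : ℂ) * ω₂)) ^ 2
      - 1 / ((p.1.1 : ℂ) * ω₁ + (p.1.2 : ℂ) * ω₂) ^ 2)

/-- The point `z_μ = (1/2 − μ)ℓ + πi`. -/
def zmu (ℓ μ : ℝ) : ℂ := (1 / 2 - (μ : ℂ)) * (ℓ : ℂ) + Real.pi * Complex.I

open scoped Classical in
/-- The cycle sum `∑_{σ ∈ Cₙ} ∏_{k=1}^n f(z_{σ(k)} − z_k)`, where `Cₙ` is the set of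
permutations of `{1,…,n}` consisting of a single `n`-cycle. -/
def cycleSum (n : ℕ) (f : ℂ → ℂ) (z : Fin n → ℂ) : ℂ :=
  ∑ σ ∈ Finset.univ.filter
      (fun σ : Equiv.Perm (Fin n) => σ.IsCycle ∧ σ.support = Finset.univ),
    ∏ k : Fin n, f (z (σ k) - z k)

/-- The open horizontal strip `S = {0 < Im z < π}`. -/
def strip : Set ℂ := {z : ℂ | 0 < z.im ∧ z.im < Real.pi}

/-- The top substrip `S_ε = {π − ε < Im z < π}`. -/
def topStrip (ε : ℝ) : Set ℂ := {z : ℂ | Real.pi - ε < z.im ∧ z.im < Real.pi}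

end
open Filter Topology

/-- Removable singularity. -/
def Rem (g : ℂ → ℂ) (z0 : ℂ) : Prop := ∃ G : ℂ → ℂ, AnalyticAt ℂ G z0 ∧ g =ᶠ[𝓝[≠] z0] G

lemma Rem.of_analytic {g : ℂ → ℂ} {z0 : ℂ} (h : AnalyticAt ℂ g z0) : Rem g z0 :=
  ⟨g, h, EventuallyEq.rfl⟩

lemma Rem.comp_add {g : ℂ → ℂ} {z0 : ℂ} (h : Rem g z0) (c : ℂ) (hc : ∀ z, g (z + c) = g z) :
    Rem g (z0 - c) := by
  obtain ⟨G, hG, he⟩ := h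
  refine ⟨fun z => G (z + c), ?_, ?_⟩
  · have : AnalyticAt ℂ G (z0 - c + c) := by simpa using hG
    exact AnalyticAt.comp (g := G) (f := fun z => z + c) this (by fun_prop)
  · rw [EventuallyEq, eventually_nhdsWithin_iff] at he ⊢
    have ht : Tendsto (fun z => z + c) (𝓝 (z0 - c)) (𝓝 z0) := by
      have : Continuous (fun z : ℂ => z + c) := by fun_prop
      simpa using this.tendsto (z0 - c)
    filter_upwards [ht.eventually he] with z hz hne
    rw [← hc z]
    exact hz (fun h => hne (by simp only [Set.mem_singleton_iff] at h ⊢; rw [← h]; ring))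

lemma Rem.comp_sub {g : ℂ → ℂ} {z0 : ℂ} (h : Rem g z0) (c : ℂ) (hc : ∀ z, g (c - z) = g z) :
    Rem g (c - z0) := by
  obtain ⟨G, hG, he⟩ := h
  refine ⟨fun z => G (c - z), ?_, ?_⟩
  · have : AnalyticAt ℂ G (c - (c - z0)) := by simpa using hG
    exact AnalyticAt.comp (g := G) (f := fun z => c - z) this (by fun_prop)
  · rw [EventuallyEq, eventually_nhdsWithin_iff] at he ⊢
    have ht : Tendsto (fun z => c - z) (𝓝 (c - z0)) (𝓝 z0) := by
      have : Continuous (fun z : ℂ => c - z) := by fun_prop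
      simpa using this.tendsto (c - z0)
    filter_upwards [ht.eventually he] with z hz hne
    rw [← hc z]
    exact hz (fun h => hne (by simp only [Set.mem_singleton_iff] at h ⊢; rw [← h]; ring))

lemma per_lattice (L : PeriodPair) (g : ℂ → ℂ) (h1 : ∀ z, g (z + L.ω₁) = g z)
    (h2 : ∀ z, g (z + L.ω₂) = g z) (z w : ℂ) (hw : w ∈ L.lattice) : g (z + w) = g z := by
  obtain ⟨m, n, rfl⟩ := PeriodPair.mem_lattice.mp hw
  have a1 := (Function.Periodic.int_mul h1 m)
  have a2 := (Function.Periodic.int_mul h2 n)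
  rw [← add_assoc, a2, a1]

lemma liou (L : PeriodPair) (g : ℂ → ℂ) (h1 : ∀ z, g (z + L.ω₁) = g z)
    (h2 : ∀ z, g (z + L.ω₂) = g z) (hl : ∀ z, Rem g z) :
    ∃ c, ∀ z, ContinuousAt g z → g z = c := by
  let gt : ℂ → ℂ := fun z => limUnder (𝓝[≠] z) g
  have key : ∀ z G, AnalyticAt ℂ G z → g =ᶠ[𝓝[≠] z] G → gt z = G z := by
    intro z G hG he
    have : Tendsto g (𝓝[≠] z) (𝓝 (G z)) :=
      (hG.continuousAt.tendsto.mono_left nhdsWithin_le_nhds).congr' he.symm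
    exact this.limUnder_eq
  have han : ∀ z, AnalyticAt ℂ gt z := by
    intro z
    obtain ⟨G, hG, he⟩ := hl z
    refine hG.congr ?_
    have h3 : ∀ᶠ w in 𝓝[≠] z, g =ᶠ[𝓝[≠] w] G := by
      have := eventually_eventually_nhdsWithin.mpr he
      have h4 : ∀ᶠ w in 𝓝[≠] z, w ≠ z := eventually_mem_nhdsWithin
      filter_upwards [this, h4] with w hw hne
      have e : 𝓝[{z}ᶜ] w = 𝓝 w := IsOpen.nhdsWithin_eq isOpen_compl_singleton hne
      rw [e] at hw
      exact hw.filter_mono nhdsWithin_le_nhds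
    have h5 : ∀ᶠ w in 𝓝 z, g =ᶠ[𝓝[≠] w] G := by
      rw [eventually_nhdsWithin_iff] at h3
      filter_upwards [h3] with w hw
      by_cases hwz : w = z
      · subst hwz; exact he
      · exact hw hwz
    filter_upwards [h5, hG.eventually_analyticAt] with w hw1 hw2
    exact (key w G hw2 hw1).symm
  have hper : ∀ z w, w ∈ L.lattice → gt (z + w) = gt z := by
    intro z w hw
    obtain ⟨G, hG, he⟩ := hl (z + w)
    rw [key _ G hG he]
    have hG' : AnalyticAt ℂ (fun x => G (x + w)) z :=
      AnalyticAt.comp (g := G) (f := fun x => x + w) hG (by fun_prop)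
    have he' : g =ᶠ[𝓝[≠] z] (fun x => G (x + w)) := by
      rw [EventuallyEq, eventually_nhdsWithin_iff] at he ⊢
      have ht : Tendsto (fun x => x + w) (𝓝 z) (𝓝 (z + w)) := by
        have : Continuous (fun z : ℂ => z + w) := by fun_prop
        simpa using this.tendsto z
      filter_upwards [ht.eventually he] with x hx hne
      rw [← per_lattice L g h1 h2 x w hw]
      exact hx (by simpa using hne)
    rw [key _ _ hG' he']
  have hd : Differentiable ℂ gt := fun z => (han z).differentiableAt
  have hb := (IsZLattice.isCompact_range_of_periodic L.lattice gt hd.continuous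
    (fun z w hw => hper z w hw)).isBounded
  refine ⟨gt 0, fun z hz => ?_⟩
  rw [← hd.apply_eq_apply_of_bounded hb z 0]
  exact ((hz.tendsto.mono_left nhdsWithin_le_nhds).limUnder_eq).symm

lemma exists_fac {f : ℂ → ℂ} {z0 : ℂ} (hf : AnalyticAt ℂ f z0) (h0 : f z0 = 0) :
    ∃ g : ℂ → ℂ, AnalyticAt ℂ g z0 ∧ ∀ z, f z = (z - z0) * g z := by
  refine ⟨dslope f z0, ?_, fun z => ?_⟩
  · obtain ⟨p, hp⟩ := hf
    exact ⟨_, hp.has_fpower_series_dslope_fslope⟩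
  · have := sub_smul_dslope f z0 z
    rw [h0, sub_zero, smul_eq_mul] at this
    exact this.symm

lemma exists_ds {f : ℂ → ℂ} (hf : Differentiable ℂ f) :
    ∃ g : ℂ → ℂ, Differentiable ℂ g ∧ (∀ z, f z = f 0 + z * g z) ∧ g 0 = deriv f 0 := by
  refine ⟨dslope f 0, ?_, fun z => ?_, dslope_same _ _⟩
  · have := (Complex.differentiableOn_dslope (f := f) (s := Set.univ) (c := 0) univ_mem).mpr
      hf.differentiableOn
    exact differentiableOn_univ.mp this
  · have := sub_smul_dslope f 0 z
    rw [sub_zero, smul_eq_mul] at this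
    rw [this]; ring

structure ThetaLike (L : PeriodPair) (α : ℂ) (Θ : ℂ → ℂ) : Prop where
  diff : Differentiable ℂ Θ
  odd : ∀ z, Θ (-z) = -Θ z
  q1 : ∀ z, Θ (z + L.ω₁) = -Θ z
  q2 : ∀ z, Θ (z + L.ω₂) = -(cexp (α * (z + L.ω₂ / 2)) * Θ z)
  zero : ∀ z, Θ z = 0 ↔ z ∈ L.lattice
  d : deriv Θ 0 ≠ 0

lemma derivP_eq {L : PeriodPair} {α : ℂ} {Θ : ℂ → ℂ} (h : ThetaLike L α Θ) (z : ℂ)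
    (hz : z ∉ L.lattice) :
    L.derivWeierstrassP z = - (deriv Θ 0 ^ 3 * Θ (2 * z) / Θ z ^ 4) := by
  have hΘan : ∀ z, AnalyticAt ℂ Θ z := fun z => h.diff.analyticAt z
  have hPan := L.analyticOnNhd_derivWeierstrassP
  have h0 : Θ 0 = 0 := (h.zero 0).2 (zero_mem _)
  set d := deriv Θ 0 with hd
  let D : ℂ → ℂ := fun z => L.derivWeierstrassP z + d ^ 3 * Θ (2 * z) / Θ z ^ 4
  have hDan : ∀ z, z ∉ L.lattice → AnalyticAt ℂ D z := by
    intro z hz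
    have h1 := hPan z hz
    have h2 : Θ z ^ 4 ≠ 0 := pow_ne_zero _ (fun hh => hz ((h.zero z).1 hh))
    have h3 : AnalyticAt ℂ (fun z => Θ (2 * z)) z :=
      AnalyticAt.comp (g := Θ) (f := fun z => 2 * z) (hΘan _) (by fun_prop)
    exact h1.add ((analyticAt_const.mul h3).div ((hΘan z).pow 4) h2)
  have p1 : ∀ z, D (z + L.ω₁) = D z := by
    intro z
    have e1 : L.derivWeierstrassP (z + L.ω₁) = L.derivWeierstrassP z :=
      L.derivWeierstrassP_add_coe z ⟨L.ω₁, L.ω₁_mem_lattice⟩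
    have e2 : Θ (2 * (z + L.ω₁)) = Θ (2 * z) := by
      rw [show 2 * (z + L.ω₁) = 2 * z + L.ω₁ + L.ω₁ by ring, h.q1, h.q1, neg_neg]
    simp only [D, e1, e2, h.q1]
    ring
  have p2 : ∀ z, D (z + L.ω₂) = D z := by
    intro z
    have e1 : L.derivWeierstrassP (z + L.ω₂) = L.derivWeierstrassP z :=
      L.derivWeierstrassP_add_coe z ⟨L.ω₂, L.ω₂_mem_lattice⟩
    have e2 : Θ (2 * (z + L.ω₂)) = cexp (α * (z + L.ω₂ / 2)) ^ 4 * Θ (2 * z) := by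
      rw [show 2 * (z + L.ω₂) = 2 * z + L.ω₂ + L.ω₂ by ring, h.q2, h.q2, ← Complex.exp_nat_mul,
        mul_neg, neg_neg, ← mul_assoc, ← Complex.exp_add]
      congr 2
      push_cast
      ring
    have hE := Complex.exp_ne_zero (α * (z + L.ω₂ / 2))
    simp only [D, e1, e2, h.q2]
    congr 1
    rw [neg_pow, mul_pow, show (-1 : ℂ) ^ 4 = 1 by norm_num, one_mul, mul_left_comm,
      mul_div_mul_left _ _ (pow_ne_zero 4 hE)]
  have r0 : Rem D 0 := by
    obtain ⟨u, hu, hu1, hu0⟩ := exists_ds h.diff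
    obtain ⟨s, hs, hs1, -⟩ := exists_ds hu
    obtain ⟨r, hr, hr1, -⟩ := exists_ds hs
    obtain ⟨t, ht, ht1, -⟩ := exists_ds hr
    rw [h0] at hu1
    rw [hu0, ← hd] at hs1
    have hsodd : ∀ z, z ≠ 0 → s (-z) = - s z := by
      intro z hz
      have a1 := h.odd z
      rw [hu1 z, hu1 (-z), hs1 z, hs1 (-z)] at a1
      have : z ^ 2 * (s (-z) + s z) = 0 := by linear_combination a1
      rcases mul_eq_zero.1 this with h' | h'
      · exact absurd (pow_eq_zero_iff (two_ne_zero) |>.1 h') hz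
      · linear_combination h'
    have hs0 : s 0 = 0 := by
      have c1 : Tendsto (fun z => s (-z) + s z) (𝓝[≠] 0) (𝓝 (s (-0) + s 0)) := by
        have : Continuous (fun z => s (-z) + s z) := by
          have := hs.continuous
          fun_prop
        exact (this.tendsto 0).mono_left nhdsWithin_le_nhds
      have c2 : Tendsto (fun z => s (-z) + s z) (𝓝[≠] 0) (𝓝 0) := by
        refine tendsto_const_nhds.congr' ?_
        filter_upwards [eventually_mem_nhdsWithin] with z hz
        rw [hsodd z hz]; ring
      have := tendsto_nhds_unique c1 c2
      rw [neg_zero] at this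
      linear_combination this / 2
    rw [hs0] at hr1
    have hu0' : u 0 ≠ 0 := by rw [hu0]; exact h.d
    have huan : AnalyticAt ℂ u 0 := hu.analyticAt 0
    have htan : Differentiable ℂ t := ht
    let M : ℂ → ℂ := fun z => 4 * d ^ 3 * (2 * t (2 * z) - t z)
      - 6 * d ^ 2 * z * r z ^ 2 - 4 * d * z ^ 3 * r z ^ 3 - z ^ 5 * r z ^ 4
    have hM : Differentiable ℂ M := by fun_prop
    refine ⟨fun z => L.derivWeierstrassPExcept 0 z + 2 * M z / u z ^ 4, ?_, ?_⟩
    · refine (L.analyticAt_derivWeierstrassPExcept 0).add ?_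
      exact (analyticAt_const.mul (hM.analyticAt 0)).div (huan.pow 4) (pow_ne_zero _ hu0')
    · have hne : ∀ᶠ z in 𝓝[≠] (0 : ℂ), u z ≠ 0 :=
        (huan.continuousAt.eventually_ne hu0').filter_mono nhdsWithin_le_nhds
      filter_upwards [hne, eventually_mem_nhdsWithin] with z hz1 hz2
      have hz2 : z ≠ 0 := hz2
      have e1 := L.derivWeierstrassPExcept_def 0 z
      simp only [ZeroMemClass.coe_zero, sub_zero] at e1
      have e2 : d ^ 3 * u (2 * z) - u z ^ 4 = z ^ 3 * M z := by
        rw [hs1 z, hs1 (2 * z), hr1 z, hr1 (2 * z)]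
        have q1 := ht1 z
        have q2 := ht1 (2 * z)
        simp only [M]
        linear_combination 4 * d ^ 3 * z ^ 2 * (q2 - q1)
      simp only [D]
      rw [e1, hu1 z, hu1 (2 * z)]
      have e3 : M z = (d ^ 3 * u (2 * z) - u z ^ 4) / z ^ 3 := by
        rw [e2]; field_simp
      rw [e3, zero_add, zero_add]
      field_simp
      ring
  have hrem : ∀ z, Rem D z := by
    intro z
    by_cases hz : z ∈ L.lattice
    · have := r0.comp_add (-z) (fun w => per_lattice L D p1 p2 w (-z) (neg_mem hz))
      simpa using this
    · exact Rem.of_analytic (hDan z hz)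
  obtain ⟨c, hc⟩ := liou L D p1 p2 hrem
  have hodd : D (-z) = - D z := by
    simp only [D]
    rw [L.derivWeierstrassP_neg, h.odd, show 2 * (-z) = -(2 * z) by ring, h.odd]
    ring
  have c1 := hc z (hDan z hz).continuousAt
  have c2 := hc (-z) (hDan (-z) (fun hh => hz (by simpa using neg_mem hh))).continuousAt
  have : D z = 0 := by rw [hodd, ← c1] at c2; linear_combination -c2 / 2
  simp only [D] at this
  linear_combination this

lemma exists_generic (L : PeriodPair) (p q : ℂ) :
    ∃ x, x ∉ L.lattice ∧ x + p ∉ L.lattice ∧ x + q ∉ L.lattice := by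
  have hc : (L.lattice : Set ℂ).Countable := by
    have : Countable L.lattice := L.latticeEquivProd.toEquiv.injective.countable
    exact Set.countable_coe_iff.mp this
  have h1 : ((fun x => x + p) ⁻¹' (L.lattice : Set ℂ)).Countable :=
    hc.preimage (add_left_injective p)
  have h2 : ((fun x => x + q) ⁻¹' (L.lattice : Set ℂ)).Countable :=
    hc.preimage (add_left_injective q)
  have h3 := (hc.union h1).union h2
  obtain ⟨x, hx⟩ := (h3.dense_compl ℝ).nonempty
  simp only [Set.mem_compl_iff, Set.mem_union, Set.mem_preimage, SetLike.mem_coe, not_or] at hx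
  exact ⟨x, hx.1.1, hx.1.2, hx.2⟩

noncomputable def Phi (Θ : ℂ → ℂ) (a x : ℂ) : ℂ := deriv Θ 0 * Θ (x - a) / (Θ (-a) * Θ x)

noncomputable def TT (Θ : ℂ → ℂ) (a y x : ℂ) : ℂ :=
  Phi Θ a x * Phi Θ a y * Phi Θ a (-x - y) + Phi Θ a (-x) * Phi Θ a (-y) * Phi Θ a (x + y)

lemma Phi_add1 {L : PeriodPair} {α : ℂ} {Θ : ℂ → ℂ} (h : ThetaLike L α Θ) (a x : ℂ) :
    Phi Θ a (x + L.ω₁) = Phi Θ a x := by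
  simp only [Phi]
  rw [show x + L.ω₁ - a = x - a + L.ω₁ by ring, h.q1, h.q1, mul_neg, mul_neg, neg_div_neg_eq]

lemma Phi_add2 {L : PeriodPair} {α : ℂ} {Θ : ℂ → ℂ} (h : ThetaLike L α Θ) (a x : ℂ) :
    Phi Θ a (x + L.ω₂) = cexp (-(α * a)) * Phi Θ a x := by
  simp only [Phi]
  rw [show x + L.ω₂ - a = x - a + L.ω₂ by ring, h.q2, h.q2, mul_neg, mul_neg, neg_div_neg_eq,
    show α * (x - a + L.ω₂ / 2) = -(α * a) + α * (x + L.ω₂ / 2) by ring, Complex.exp_add]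
  have hE := Complex.exp_ne_zero (α * (x + L.ω₂ / 2))
  rw [show deriv Θ 0 * (cexp (-(α * a)) * cexp (α * (x + L.ω₂ / 2)) * Θ (x - a)) =
      cexp (α * (x + L.ω₂ / 2)) * (cexp (-(α * a)) * (deriv Θ 0 * Θ (x - a))) by ring,
    show Θ (-a) * (cexp (α * (x + L.ω₂ / 2)) * Θ x) =
      cexp (α * (x + L.ω₂ / 2)) * (Θ (-a) * Θ x) by ring, mul_div_mul_left _ _ hE, mul_div_assoc]

lemma Phi_sub1 {L : PeriodPair} {α : ℂ} {Θ : ℂ → ℂ} (h : ThetaLike L α Θ) (a x : ℂ) :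
    Phi Θ a (x - L.ω₁) = Phi Θ a x := by
  rw [← Phi_add1 h, sub_add_cancel]

lemma Phi_sub2 {L : PeriodPair} {α : ℂ} {Θ : ℂ → ℂ} (h : ThetaLike L α Θ) (a x : ℂ) :
    Phi Θ a (x - L.ω₂) = cexp (α * a) * Phi Θ a x := by
  have := Phi_add2 h a (x - L.ω₂)
  rw [sub_add_cancel] at this
  rw [this, ← mul_assoc, ← Complex.exp_add, add_neg_cancel, Complex.exp_zero, one_mul]

lemma Phi_analytic {L : PeriodPair} {α : ℂ} {Θ : ℂ → ℂ} (h : ThetaLike L α Θ) {a x : ℂ}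
    (ha : a ∉ L.lattice) (hx : x ∉ L.lattice) : AnalyticAt ℂ (Phi Θ a) x := by
  have hΘan : ∀ z, AnalyticAt ℂ Θ z := fun z => h.diff.analyticAt z
  have h3 : AnalyticAt ℂ (fun z => Θ (z - a)) x :=
    AnalyticAt.comp (g := Θ) (f := fun z => z - a) (hΘan _) (by fun_prop)
  refine (analyticAt_const.mul h3).div (analyticAt_const.mul (hΘan x)) (mul_ne_zero ?_ ?_)
  · exact fun hh => ha (by simpa using neg_mem ((h.zero _).1 hh))
  · exact fun hh => hx ((h.zero _).1 hh)

lemma TT_const {L : PeriodPair} {α : ℂ} {Θ : ℂ → ℂ} (h : ThetaLike L α Θ) {a y : ℂ}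
    (ha : a ∉ L.lattice) (hy : y ∉ L.lattice) :
    ∃ c, ∀ x, x ∉ L.lattice → x + y ∉ L.lattice → TT Θ a y x = c := by
  have hΘan : ∀ z, AnalyticAt ℂ Θ z := fun z => h.diff.analyticAt z
  have h0 : Θ 0 = 0 := (h.zero 0).2 (zero_mem _)
  have hny : -y ∉ L.lattice := fun hh => hy (by simpa using neg_mem hh)
  have hΘa : Θ (-a) ≠ 0 := fun hh => ha (by simpa using neg_mem ((h.zero _).1 hh))
  have p1 : ∀ x, TT Θ a y (x + L.ω₁) = TT Θ a y x := by
    intro x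
    simp only [TT]
    rw [show -(x + L.ω₁) - y = -x - y - L.ω₁ by ring, show -(x + L.ω₁) = -x - L.ω₁ by ring,
      show x + L.ω₁ + y = x + y + L.ω₁ by ring]
    simp only [Phi_add1 h, Phi_sub1 h]
  have p2 : ∀ x, TT Θ a y (x + L.ω₂) = TT Θ a y x := by
    intro x
    simp only [TT]
    rw [show -(x + L.ω₂) - y = -x - y - L.ω₂ by ring, show -(x + L.ω₂) = -x - L.ω₂ by ring,
      show x + L.ω₂ + y = x + y + L.ω₂ by ring]
    simp only [Phi_add2 h, Phi_sub2 h]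
    have hE : cexp (α * a) * cexp (-(α * a)) = 1 := by
      rw [← Complex.exp_add, add_neg_cancel, Complex.exp_zero]
    linear_combination (Phi Θ a x * Phi Θ a y * Phi Θ a (-x - y)
      + Phi Θ a (-x) * Phi Θ a (-y) * Phi Θ a (x + y)) * hE
  have an1 : ∀ x, x + y ∉ L.lattice → AnalyticAt ℂ (fun x => Phi Θ a (x + y)) x := fun x hx =>
    AnalyticAt.comp (g := Phi Θ a) (f := fun x => x + y) (Phi_analytic h ha hx) (by fun_prop)
  have an2 : ∀ x, x + y ∉ L.lattice → AnalyticAt ℂ (fun x => Phi Θ a (-x - y)) x := fun x hx =>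
    AnalyticAt.comp (g := Phi Θ a) (f := fun x => -x - y) (Phi_analytic h ha
      (fun hh => hx (by have := neg_mem hh; rwa [show -(-x - y) = x + y by ring] at this)))
      (by fun_prop)
  have an3 : ∀ x, x ∉ L.lattice → AnalyticAt ℂ (fun x => Phi Θ a (-x)) x := fun x hx =>
    AnalyticAt.comp (g := Phi Θ a) (f := fun x => -x) (Phi_analytic h ha
      (fun hh => hx (by simpa using neg_mem hh))) (by fun_prop)
  have han : ∀ x, x ∉ L.lattice → x + y ∉ L.lattice → AnalyticAt ℂ (TT Θ a y) x := by
    intro x hx hxy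
    exact (((Phi_analytic h ha hx).mul analyticAt_const).mul (an2 x hxy)).add
      (((an3 x hx).mul analyticAt_const).mul (an1 x hxy))
  have r0 : Rem (TT Θ a y) 0 := by
    obtain ⟨u, hu, hu1, hu0⟩ := exists_ds h.diff
    rw [h0] at hu1
    have hu0' : u 0 ≠ 0 := by rw [hu0]; exact h.d
    have hy' : 0 + y ∉ L.lattice := by simpa using hy
    let H : ℂ → ℂ := fun x => deriv Θ 0 * Θ (x - a) / (Θ (-a) * u x)
    have hH : AnalyticAt ℂ H 0 := by
      have h3 : AnalyticAt ℂ (fun z => Θ (z - a)) 0 :=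
        AnalyticAt.comp (g := Θ) (f := fun z => z - a) (hΘan _) (by fun_prop)
      exact (analyticAt_const.mul h3).div (analyticAt_const.mul (hu.analyticAt 0))
        (mul_ne_zero hΘa hu0')
    have hHn : AnalyticAt ℂ (fun x => H (-x)) 0 :=
      AnalyticAt.comp (g := H) (f := fun x => -x) (by simpa using hH) (by fun_prop)
    have hF : AnalyticAt ℂ (fun x => H x * Phi Θ a y * Phi Θ a (-x - y)
        - H (-x) * Phi Θ a (-y) * Phi Θ a (x + y)) 0 :=
      ((hH.mul analyticAt_const).mul (an2 0 hy')).sub ((hHn.mul analyticAt_const).mul (an1 0 hy'))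
    obtain ⟨g, hg, hg1⟩ := exists_fac hF (by simp; ring)
    refine ⟨g, hg, ?_⟩
    filter_upwards [eventually_mem_nhdsWithin] with x hx
    have hx : x ≠ 0 := hx
    have hPhi : ∀ x, Phi Θ a x = x⁻¹ * H x := by
      intro x
      simp only [Phi, H]
      rw [hu1 x, zero_add, div_eq_mul_inv, div_eq_mul_inv, mul_inv, mul_inv, mul_inv]
      ring
    have e := hg1 x
    simp only [sub_zero] at e
    have : g x = x⁻¹ * (x * g x) := by field_simp
    rw [this, ← e]
    simp only [TT]
    rw [hPhi x, hPhi (-x), inv_neg]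
    ring
  have hsym : ∀ x, TT Θ a y (-y - x) = TT Θ a y x := by
    intro x
    simp only [TT]
    rw [show -(-y - x) - y = x by ring, show -(-y - x) = x + y by ring,
      show -y - x + y = -x by ring, show -y - x = -x - y by ring]
    ring
  have hrem : ∀ x, Rem (TT Θ a y) x := by
    intro x
    by_cases hx : x ∈ L.lattice
    · have := r0.comp_add (-x) (fun w => per_lattice L _ p1 p2 w (-x) (neg_mem hx))
      simpa using this
    by_cases hxy : x + y ∈ L.lattice
    · have := (r0.comp_sub (-y) hsym).comp_add (-(x + y))
        (fun w => per_lattice L _ p1 p2 w _ (neg_mem hxy))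
      rwa [show -y - 0 - -(x + y) = x by ring] at this
    · exact Rem.of_analytic (han x hx hxy)
  obtain ⟨c, hc⟩ := liou L _ p1 p2 hrem
  exact ⟨c, fun x hx hxy => hc x (han x hx hxy).continuousAt⟩

lemma TT_comm (Θ : ℂ → ℂ) (a x y : ℂ) : TT Θ a y x = TT Θ a x y := by
  simp only [TT]
  rw [show -x - y = -y - x by ring, add_comm x y]
  ring

lemma TT_eq {L : PeriodPair} {α : ℂ} {Θ : ℂ → ℂ} (h : ThetaLike L α Θ) {a x y : ℂ}
    (ha : a ∉ L.lattice) (hx : x ∉ L.lattice) (hy : y ∉ L.lattice) (hxy : x + y ∉ L.lattice) :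
    TT Θ a y x = L.derivWeierstrassP a := by
  have h0 : Θ 0 = 0 := (h.zero 0).2 (zero_mem _)
  obtain ⟨w, hw, hwy, hwa⟩ := exists_generic L y a
  obtain ⟨c, hc⟩ := TT_const h ha hy
  obtain ⟨c', hc'⟩ := TT_const h ha hw
  have e1 : TT Θ a y x = TT Θ a w a := by
    rw [hc x hx hxy, ← hc w hw hwy, TT_comm, hc' y hy (by rwa [add_comm]),
      hc' a ha (by rwa [add_comm])]
  rw [e1, derivP_eq h a ha]
  have n1 : Θ a ≠ 0 := fun hh => ha ((h.zero _).1 hh)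
  have n2 : Θ w ≠ 0 := fun hh => hw ((h.zero _).1 hh)
  have n3 : Θ (w + a) ≠ 0 := fun hh => hwa ((h.zero _).1 hh)
  simp only [TT, Phi, sub_self, h0]
  rw [show -a - a = -(2 * a) by ring, show -w - a = -(w + a) by ring,
    show a + w - a = w by ring, add_comm a w]
  simp only [h.odd]
  field_simp
  ring

noncomputable def Qp (p u : ℂ) : ℂ := ∏' n : ℕ, (1 + -(p ^ n * u))

lemma Qp_summable {p : ℂ} (hp : ‖p‖ < 1) (u : ℂ) : Summable (fun n : ℕ => ‖-(p ^ n * u)‖) := by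
  simp only [norm_neg, norm_mul, norm_pow]
  exact (summable_geometric_of_lt_one (norm_nonneg _) hp).mul_right _

lemma Qp_step {p : ℂ} (hp : ‖p‖ < 1) (u : ℂ) : Qp p u = (1 - u) * Qp p (p * u) := by
  have hm : Multipliable (fun n : ℕ => (1 + -(p ^ (n + 1) * u))) := by
    refine multipliable_one_add_of_summable ?_
    exact (summable_nat_add_iff 1).mpr (Qp_summable hp u)
  have := tprod_eq_zero_mul' (f := fun n : ℕ => (1 + -(p ^ n * u))) hm
  simp only [Qp]
  rw [this]
  congr 1
  · simp; ring
  · refine tprod_congr (fun n => ?_)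
    ring

lemma Qp_ne {p : ℂ} (hp : ‖p‖ < 1) (u : ℂ) (h : ∀ n : ℕ, p ^ n * u ≠ 1) : Qp p u ≠ 0 := by
  refine tprod_one_add_ne_zero_of_summable (fun n hn => h n ?_) (Qp_summable hp u)
  linear_combination -hn

lemma Qp_diff {p : ℂ} (hp : ‖p‖ < 1) : Differentiable ℂ (Qp p) := by
  intro u
  have h1 : HasProdLocallyUniformlyOn (fun (n : ℕ) (x : ℂ) ↦ 1 + -(p ^ n * x))
      (fun x ↦ ∏' i : ℕ, (1 + -(p ^ i * x))) (Metric.ball 0 (‖u‖ + 1)) := by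
    refine Summable.hasProdLocallyUniformlyOn_nat_one_add Metric.isOpen_ball
      (u := fun n => ‖p‖ ^ n * (‖u‖ + 1)) ?_ ?_ ?_
    · exact (summable_geometric_of_lt_one (norm_nonneg _) hp).mul_right _
    · refine Eventually.of_forall (fun n x hx => ?_)
      rw [norm_neg, norm_mul, norm_pow]
      have : ‖x‖ < ‖u‖ + 1 := by simpa using hx
      gcongr
    · intro n; fun_prop
  have h2 := h1.differentiableOn (.of_forall fun s ↦ by
    simpa [Finset.prod_fn] using DifferentiableOn.finsetProd (fun _ _ ↦ by fun_prop))
    Metric.isOpen_ball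
  exact h2.differentiableAt (Metric.isOpen_ball.mem_nhds (by simp))

noncomputable def pairOne (τ : ℂ) (hτ : 0 < τ.im) : PeriodPair where
  ω₁ := 1
  ω₂ := τ
  indep := by
    rw [LinearIndependent.pair_iff]
    intro s t h
    have h2 := congrArg Complex.im h
    simp at h2
    have h1 := congrArg Complex.re h
    rcases h2 with h2 | h2
    · subst h2; simp at h1; exact ⟨h1, rfl⟩
    · exact absurd h2 hτ.ne'

noncomputable def EE (τ w : ℂ) : ℂ :=
  Qp (cexp (2 * Real.pi * I * τ)) (cexp (2 * Real.pi * I * w)) *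
    Qp (cexp (2 * Real.pi * I * τ)) (cexp (2 * Real.pi * I * τ) * cexp (-(2 * Real.pi * I * w)))

lemma p_lt {τ : ℂ} (hτ : 0 < τ.im) : ‖cexp (2 * Real.pi * I * τ)‖ < 1 := by
  rw [Complex.norm_exp, Real.exp_lt_one_iff]
  simp
  positivity

lemma exp_int_pi (m : ℤ) : cexp (2 * Real.pi * I * m) = 1 := by
  rw [show 2 * (Real.pi : ℂ) * I * m = m * (2 * Real.pi * I) by ring]
  exact Complex.exp_int_mul_two_pi_mul_I m

lemma two_pi_I_cancel {x y : ℂ} (h : 2 * (Real.pi : ℂ) * I * x = 2 * (Real.pi : ℂ) * I * y) :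
    x = y := mul_left_cancel₀ Complex.two_pi_I_ne_zero h

lemma EE_ne {τ : ℂ} (hτ : 0 < τ.im) (w : ℂ) (hw : w ∉ (pairOne τ hτ).lattice) : EE τ w ≠ 0 := by
  refine mul_ne_zero (Qp_ne (p_lt hτ) _ fun n hn => hw ?_) (Qp_ne (p_lt hτ) _ fun n hn => hw ?_)
  · rw [← Complex.exp_nat_mul, ← Complex.exp_add, Complex.exp_eq_one_iff] at hn
    obtain ⟨m, hm⟩ := hn
    rw [PeriodPair.mem_lattice]
    refine ⟨m, -n, ?_⟩
    apply two_pi_I_cancel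
    simp only [pairOne]
    push_cast
    linear_combination -hm
  · rw [← mul_assoc, ← pow_succ, ← Complex.exp_nat_mul, ← Complex.exp_add,
      Complex.exp_eq_one_iff] at hn
    obtain ⟨m, hm⟩ := hn
    rw [PeriodPair.mem_lattice]
    refine ⟨-m, n + 1, ?_⟩
    apply two_pi_I_cancel
    simp only [pairOne]
    push_cast at hm ⊢
    linear_combination hm

lemma EE_diff {τ : ℂ} (hτ : 0 < τ.im) : Differentiable ℂ (EE τ) := by
  have := Qp_diff (p_lt hτ)
  unfold EE
  fun_prop

lemma EE_add1 (τ w : ℂ) : EE τ (w + 1) = EE τ w := by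
  have h1 : cexp (2 * Real.pi * I * (w + 1)) = cexp (2 * Real.pi * I * w) := by
    rw [mul_add, Complex.exp_add, mul_one, Complex.exp_two_pi_mul_I, mul_one]
  simp only [EE, Complex.exp_neg, h1]

lemma EE_fac {τ : ℂ} (hτ : 0 < τ.im) (w : ℂ) : EE τ w = (1 - cexp (2 * Real.pi * I * w)) *
    (Qp (cexp (2 * Real.pi * I * τ)) (cexp (2 * Real.pi * I * τ) * cexp (2 * Real.pi * I * w)) *
    Qp (cexp (2 * Real.pi * I * τ))
      (cexp (2 * Real.pi * I * τ) * cexp (-(2 * Real.pi * I * w)))) := by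
  rw [EE, Qp_step (p_lt hτ) (cexp (2 * Real.pi * I * w)), mul_assoc]

lemma EE_add2 {τ : ℂ} (hτ : 0 < τ.im) (w : ℂ) :
    EE τ (w + τ) = -(cexp (-(2 * Real.pi * I * w)) * EE τ w) := by
  rw [EE_fac hτ w, EE]
  have h1 : cexp (2 * Real.pi * I * (w + τ)) =
      cexp (2 * Real.pi * I * τ) * cexp (2 * Real.pi * I * w) := by
    rw [← Complex.exp_add]; ring_nf
  have h2 : cexp (2 * Real.pi * I * τ) * cexp (-(2 * Real.pi * I * (w + τ))) =
      cexp (-(2 * Real.pi * I * w)) := by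
    rw [← Complex.exp_add]; ring_nf
  rw [h1, h2, Qp_step (p_lt hτ) (cexp (-(2 * Real.pi * I * w)))]
  have h3 : cexp (-(2 * Real.pi * I * w)) * cexp (2 * Real.pi * I * w) = 1 := by
    rw [← Complex.exp_add, neg_add_cancel, Complex.exp_zero]
  linear_combination (- (Qp (cexp (2 * Real.pi * I * τ))
    (cexp (2 * Real.pi * I * τ) * cexp (2 * Real.pi * I * w)) *
    Qp (cexp (2 * Real.pi * I * τ))
      (cexp (2 * Real.pi * I * τ) * cexp (-(2 * Real.pi * I * w))))) * h3

lemma EE_zero {τ : ℂ} (hτ : 0 < τ.im) : EE τ 0 = 0 := by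
  rw [EE_fac hτ]; simp

lemma EE_deriv {τ : ℂ} (hτ : 0 < τ.im) : deriv (EE τ) 0 ≠ 0 := by
  have hQ := Qp_diff (p_lt hτ)
  let R : ℂ → ℂ := fun w =>
    Qp (cexp (2 * Real.pi * I * τ)) (cexp (2 * Real.pi * I * τ) * cexp (2 * Real.pi * I * w)) *
    Qp (cexp (2 * Real.pi * I * τ))
      (cexp (2 * Real.pi * I * τ) * cexp (-(2 * Real.pi * I * w)))
  have hR : Differentiable ℂ R := by fun_prop
  have he : EE τ = fun w => (1 - cexp (2 * Real.pi * I * w)) * R w := by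
    ext w; exact EE_fac hτ w
  have hR0 : R 0 ≠ 0 := by
    have : Qp (cexp (2 * Real.pi * I * τ)) (cexp (2 * Real.pi * I * τ)) ≠ 0 := by
      refine Qp_ne (p_lt hτ) _ fun n hn => ?_
      rw [← pow_succ] at hn
      have h1 := congrArg norm hn
      rw [norm_pow, norm_one] at h1
      exact (pow_lt_one₀ (norm_nonneg _) (p_lt hτ) (Nat.succ_ne_zero n)).ne h1
    simp only [R, mul_zero, neg_zero, Complex.exp_zero, mul_one]
    exact mul_ne_zero this this
  have h1 : HasDerivAt (fun w => 1 - cexp (2 * Real.pi * I * w)) (-(2 * Real.pi * I)) 0 := by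
    have a1 : HasDerivAt (fun w : ℂ => 2 * Real.pi * I * w) (2 * Real.pi * I) 0 := by
      simpa using (hasDerivAt_id (0 : ℂ)).const_mul (2 * Real.pi * I)
    have a2 := (a1.cexp).const_sub 1
    simpa using a2
  have h2 := h1.mul (hR 0).hasDerivAt
  have h3 : HasDerivAt (EE τ) (-(2 * Real.pi * I) * R 0) 0 := by
    rw [he]
    refine HasDerivAt.congr_deriv h2 ?_
    rw [mul_zero, Complex.exp_zero, sub_self, zero_mul, add_zero]
  rw [h3.deriv]
  exact mul_ne_zero (neg_ne_zero.2 Complex.two_pi_I_ne_zero) hR0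

noncomputable def JJ (τ w : ℂ) : ℂ := jacobiTheta₂ (w + 1 / 2 - τ / 2) τ

lemma JJ_diff {τ : ℂ} (hτ : 0 < τ.im) : Differentiable ℂ (JJ τ) := by
  intro w
  have h1 := differentiableAt_jacobiTheta₂_fst (w + 1 / 2 - τ / 2) hτ
  have h2 : DifferentiableAt ℂ (fun w : ℂ => w + 1 / 2 - τ / 2) w := by fun_prop
  exact DifferentiableAt.comp (g := fun z => jacobiTheta₂ z τ) w h1 h2

lemma JJ_add1 (τ w : ℂ) : JJ τ (w + 1) = JJ τ w := by
  rw [JJ, show w + 1 + 1 / 2 - τ / 2 = w + 1 / 2 - τ / 2 + 1 by ring, jacobiTheta₂_add_left, JJ]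

lemma exp_shift (x : ℂ) : cexp (x - Real.pi * I) = - cexp x := by
  rw [Complex.exp_sub, Complex.exp_pi_mul_I, div_neg, div_one]

lemma JJ_add2 (τ w : ℂ) : JJ τ (w + τ) = -(cexp (-(2 * Real.pi * I * w)) * JJ τ w) := by
  rw [JJ, show w + τ + 1 / 2 - τ / 2 = w + 1 / 2 - τ / 2 + τ by ring, jacobiTheta₂_add_left', JJ,
    ← neg_mul, ← exp_shift]
  congr 2
  ring

lemma JJ_neg (τ w : ℂ) : JJ τ (-w) = -(cexp (-(2 * Real.pi * I * w)) * JJ τ w) := by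
  rw [JJ, show -w + 1 / 2 - τ / 2 = -(w - 1 / 2 - τ / 2 + τ) by ring, jacobiTheta₂_neg_left,
    jacobiTheta₂_add_left', JJ, show w + 1 / 2 - τ / 2 = w - 1 / 2 - τ / 2 + 1 by ring,
    jacobiTheta₂_add_left, show -(Real.pi : ℂ) * I * (τ + 2 * (w - 1 / 2 - τ / 2)) =
      -(2 * Real.pi * I * w) - Real.pi * I + 2 * Real.pi * I by ring,
    Complex.exp_add, Complex.exp_two_pi_mul_I, exp_shift]
  ring

lemma JJ_zero (τ : ℂ) : JJ τ 0 = 0 := by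
  have := JJ_neg τ 0
  simp at this
  linear_combination this / 2

lemma JJ_main {τ : ℂ} (hτ : 0 < τ.im) (w0 : ℂ) (h0 : jacobiTheta₂ w0 τ ≠ 0) :
    (∀ w, JJ τ w = 0 ↔ w ∈ (pairOne τ hτ).lattice) ∧ deriv (JJ τ) 0 ≠ 0 := by
  classical
  set L := pairOne τ hτ with hL
  have hJ := JJ_diff hτ
  have hE := EE_diff hτ
  have hexp : ∀ w : ℂ, cexp (-(2 * Real.pi * I * w)) ≠ 0 := fun w => Complex.exp_ne_zero _
  have hlat : ∀ w ∈ L.lattice, JJ τ w = 0 := by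
    intro w hw
    have := per_lattice L (fun w => if JJ τ w = 0 then 0 else 1)
      (fun z => by simp only [hL, pairOne, JJ_add1])
      (fun z => by simp [hL, pairOne, JJ_add2]) 0 w hw
    simp only [zero_add, JJ_zero, if_true] at this
    by_contra hc
    simp [hc] at this
  let g : ℂ → ℂ := fun w => JJ τ w / EE τ w
  have p1 : ∀ z, g (z + L.ω₁) = g z := fun z => by
    change JJ τ (z + 1) / EE τ (z + 1) = _
    rw [JJ_add1, EE_add1]
  have p2 : ∀ z, g (z + L.ω₂) = g z := fun z => by
    change JJ τ (z + τ) / EE τ (z + τ) = _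
    rw [JJ_add2, EE_add2 hτ, neg_div_neg_eq, mul_div_mul_left _ _ (hexp z)]
  have han : ∀ z, z ∉ L.lattice → AnalyticAt ℂ g z := fun z hz =>
    (hJ.analyticAt z).div (hE.analyticAt z) (EE_ne hτ z hz)
  have r0 : Rem g 0 := by
    obtain ⟨j, hj, hj1, -⟩ := exists_ds hJ
    obtain ⟨e, he, he1, he0⟩ := exists_ds hE
    rw [JJ_zero] at hj1
    rw [EE_zero hτ] at he1
    refine ⟨fun z => j z / e z, (hj.analyticAt 0).div (he.analyticAt 0) ?_, ?_⟩
    · rw [he0]; exact EE_deriv hτ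
    · filter_upwards [eventually_mem_nhdsWithin] with z hz
      have hz : z ≠ 0 := hz
      simp only [g]
      rw [hj1, he1, zero_add, zero_add, mul_div_mul_left _ _ hz]
  have hrem : ∀ z, Rem g z := by
    intro z
    by_cases hz : z ∈ L.lattice
    · have := r0.comp_add (-z) (fun w => per_lattice L g p1 p2 w (-z) (neg_mem hz))
      simpa using this
    · exact Rem.of_analytic (han z hz)
  obtain ⟨c, hc⟩ := liou L g p1 p2 hrem
  have hce : ∀ z, z ∉ L.lattice → JJ τ z = c * EE τ z := fun z hz => by
    have := hc z (han z hz).continuousAt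
    rw [← this]
    exact (div_mul_cancel₀ _ (EE_ne hτ z hz)).symm
  have hw0 : JJ τ (w0 - 1 / 2 + τ / 2) ≠ 0 := by
    rw [JJ, show w0 - 1 / 2 + τ / 2 + 1 / 2 - τ / 2 = w0 by ring]
    exact h0
  have hc0 : c ≠ 0 := by
    rintro rfl
    refine hw0 ?_
    rw [hce _ (fun hh => hw0 (hlat _ hh)), zero_mul]
  refine ⟨fun w => ⟨fun hw => ?_, hlat w⟩, ?_⟩
  · by_contra hn
    rw [hce w hn] at hw
    exact mul_ne_zero hc0 (EE_ne hτ w hn) hw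
  · have hev : JJ τ =ᶠ[𝓝 0] fun z => c * EE τ z := by
      filter_upwards [L.compl_lattice_sdiff_singleton_mem_nhds 0] with z hz
      by_cases hz0 : z = 0
      · rw [hz0, JJ_zero, EE_zero hτ, mul_zero]
      · refine hce z (fun hh => hz ⟨hh, hz0⟩)
    rw [hev.deriv_eq, deriv_const_mul _ (hE 0)]
    exact mul_ne_zero hc0 (EE_deriv hτ)

lemma theta3_eq (τ w : ℂ) : theta3 τ w = jacobiTheta₂ w τ := by
  unfold theta3 jacobiTheta₂
  apply tsum_congr
  intro n
  rw [jacobiTheta₂_term, ← Complex.exp_add]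
  ring_nf

lemma theta1_eq (τ w : ℂ) : theta1 τ w =
    -I * (cexp (Real.pi * I * τ / 4 + Real.pi * I * w) * jacobiTheta₂ (w + 1 / 2 + τ / 2) τ) := by
  unfold theta1 jacobiTheta₂
  congr 1
  rw [← tsum_mul_left]
  refine tsum_congr (fun n => ?_)
  have h : ((-1 : ℂ)) ^ n = cexp (Real.pi * I * n) := by
    rw [show (Real.pi : ℂ) * I * n = n * (Real.pi * I) by ring, Complex.exp_int_mul,
      Complex.exp_pi_mul_I]
  rw [h, jacobiTheta₂_term, ← Complex.exp_add, ← Complex.exp_add, ← Complex.exp_add]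
  ring_nf

lemma theta1_JJ (τ w : ℂ) : theta1 τ w =
    I * (cexp (Real.pi * I * τ / 4 - Real.pi * I * w) * JJ τ w) := by
  have h := JJ_add2 τ w
  rw [JJ, show w + τ + 1 / 2 - τ / 2 = w + 1 / 2 + τ / 2 by ring] at h
  have h2 : cexp (Real.pi * I * τ / 4 - Real.pi * I * w) =
      cexp (Real.pi * I * τ / 4 + Real.pi * I * w) * cexp (-(2 * Real.pi * I * w)) := by
    rw [← Complex.exp_add]
    ring_nf
  rw [theta1_eq, h, h2]
  ring

noncomputable def pairL (ℓ : ℝ) (hℓ : 0 < ℓ) : PeriodPair where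
  ω₁ := (ℓ : ℂ)
  ω₂ := 2 * Real.pi * Complex.I
  indep := by
    rw [LinearIndependent.pair_iff]
    intro s t h
    have h2 := congrArg Complex.im h
    have h1 := congrArg Complex.re h
    simp at h2 h1
    exact ⟨h1.resolve_right hℓ.ne', h2⟩

lemma lat_iff (ℓ : ℝ) (hℓ : 0 < ℓ) (z : ℂ) :
    z ∈ lat (ℓ : ℂ) (2 * Real.pi * Complex.I) ↔ z ∈ (pairL ℓ hℓ).lattice := by
  rw [PeriodPair.mem_lattice]
  simp only [lat, Set.mem_ofPred_eq, pairL]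
  exact ⟨fun ⟨m, n, h⟩ => ⟨m, n, h.symm⟩, fun ⟨m, n, h⟩ => ⟨m, n, h.symm⟩⟩

lemma tau_im (ℓ : ℝ) (hℓ : 0 < ℓ) : 0 < (tau ℓ).im := by
  have : tau ℓ = ((2 * Real.pi / ℓ : ℝ) : ℂ) * I := by
    rw [tau]; push_cast; ring
  rw [this, Complex.im_ofReal_mul, Complex.I_im, mul_one]
  positivity

lemma lat_scale (ℓ : ℝ) (hℓ : 0 < ℓ) (z : ℂ) :
    z / (ℓ : ℂ) ∈ (pairOne (tau ℓ) (tau_im ℓ hℓ)).lattice ↔ z ∈ (pairL ℓ hℓ).lattice := by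
  have h0 : (ℓ : ℂ) ≠ 0 := by exact_mod_cast hℓ.ne'
  rw [PeriodPair.mem_lattice, PeriodPair.mem_lattice]
  simp only [pairOne, pairL, tau]
  refine exists_congr fun m => exists_congr fun n => ?_
  rw [eq_div_iff h0]
  rw [show ((m : ℂ) * 1 + n * (2 * Real.pi * I / ℓ)) * ℓ = m * ℓ + n * (2 * Real.pi * I) by
    field_simp]

lemma theta1_neg (τ w : ℂ) : theta1 τ (-w) = -theta1 τ w := by
  rw [theta1_JJ, theta1_JJ, JJ_neg]
  have h2 : cexp (Real.pi * I * τ / 4 - Real.pi * I * w) =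
      cexp (Real.pi * I * τ / 4 - Real.pi * I * -w) * cexp (-(2 * Real.pi * I * w)) := by
    rw [← Complex.exp_add]
    ring_nf
  rw [h2]
  ring

lemma theta1_add1 (τ w : ℂ) : theta1 τ (w + 1) = -theta1 τ w := by
  rw [theta1_JJ, theta1_JJ, JJ_add1]
  rw [show (Real.pi : ℂ) * I * τ / 4 - Real.pi * I * (w + 1) =
    Real.pi * I * τ / 4 - Real.pi * I * w - Real.pi * I by ring, exp_shift]
  ring

lemma theta1_add2 (τ w : ℂ) :
    theta1 τ (w + τ) = -(cexp (-(2 * Real.pi * I) * (w + τ / 2)) * theta1 τ w) := by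
  rw [theta1_JJ, theta1_JJ, JJ_add2]
  have h2 : cexp (Real.pi * I * τ / 4 - Real.pi * I * (w + τ)) * cexp (-(2 * Real.pi * I * w)) =
      cexp (-(2 * Real.pi * I) * (w + τ / 2)) * cexp (Real.pi * I * τ / 4 - Real.pi * I * w) := by
    rw [← Complex.exp_add, ← Complex.exp_add]
    ring_nf
  linear_combination (-I * JJ τ w) * h2

lemma theta1_diff {τ : ℂ} (hτ : 0 < τ.im) : Differentiable ℂ (theta1 τ) := by
  have : theta1 τ = fun w => I * (cexp (Real.pi * I * τ / 4 - Real.pi * I * w) * JJ τ w) := by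
    ext w; exact theta1_JJ τ w
  rw [this]
  have := JJ_diff hτ
  fun_prop

lemma theta1_deriv {τ : ℂ} (hτ : 0 < τ.im) :
    deriv (theta1 τ) 0 = I * (cexp (Real.pi * I * τ / 4) * deriv (JJ τ) 0) := by
  have he : theta1 τ = fun w => I * (cexp (Real.pi * I * τ / 4 - Real.pi * I * w) * JJ τ w) := by
    ext w; exact theta1_JJ τ w
  have h1 : DifferentiableAt ℂ (fun w : ℂ => cexp (Real.pi * I * τ / 4 - Real.pi * I * w)) 0 := by
    fun_prop
  have h2 := (h1.hasDerivAt.mul (JJ_diff hτ 0).hasDerivAt).const_mul I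
  rw [he]
  refine (HasDerivAt.congr_deriv h2 ?_).deriv
  rw [JJ_zero, mul_zero, zero_add, mul_zero, sub_zero]

noncomputable def TH (ℓ : ℝ) (z : ℂ) : ℂ := theta1 (tau ℓ) (z / (ℓ : ℂ))

lemma TH_deriv (ℓ : ℝ) (hℓ : 0 < ℓ) :
    deriv (TH ℓ) 0 = (ℓ : ℂ)⁻¹ * deriv (theta1 (tau ℓ)) 0 := by
  have h1 : HasDerivAt (fun z : ℂ => z / (ℓ : ℂ)) ((ℓ : ℂ)⁻¹) 0 := by
    simpa using (hasDerivAt_id (0 : ℂ)).div_const (ℓ : ℂ)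
  have h2 := (theta1_diff (tau_im ℓ hℓ) ((0 : ℂ) / (ℓ : ℂ))).hasDerivAt
  have h3 := HasDerivAt.comp (0 : ℂ) h2 h1
  rw [zero_div] at h3
  rw [mul_comm]
  exact h3.deriv

lemma TH_like (ℓ μ : ℝ) (hℓ : 0 < ℓ) (hμ : theta3 (tau ℓ) (μ : ℂ) ≠ 0) :
    ThetaLike (pairL ℓ hℓ) (-(2 * Real.pi * I) / ℓ) (TH ℓ) := by
  have h0 : (ℓ : ℂ) ≠ 0 := by exact_mod_cast hℓ.ne'
  rw [theta3_eq] at hμ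
  obtain ⟨hz, hd⟩ := JJ_main (tau_im ℓ hℓ) _ hμ
  have := theta1_diff (tau_im ℓ hℓ)
  refine ⟨?_, ?_, ?_, ?_, ?_, ?_⟩
  · unfold TH
    exact this.comp (differentiable_id.div_const _)
  · intro z
    rw [TH, neg_div, theta1_neg, TH]
  · intro z
    change theta1 _ ((z + ℓ) / ℓ) = _
    rw [add_div, div_self h0, theta1_add1, TH]
  · intro z
    change theta1 _ ((z + 2 * Real.pi * I) / ℓ) =
      -(cexp (_ * (z + 2 * Real.pi * I / 2)) * _)
    rw [add_div, show 2 * (Real.pi : ℂ) * I / ℓ = tau ℓ from rfl, theta1_add2, TH,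
      show -(2 * (Real.pi : ℂ) * I) * (z / ℓ + tau ℓ / 2) =
      -(2 * (Real.pi : ℂ) * I) / ℓ * (z + 2 * Real.pi * I / 2) by rw [tau]; field_simp]
  · intro z
    rw [← lat_scale ℓ hℓ z, ← hz, TH, theta1_JJ]
    simp
  · rw [TH_deriv ℓ hℓ, theta1_deriv (tau_im ℓ hℓ)]
    exact mul_ne_zero (inv_ne_zero h0) (mul_ne_zero I_ne_zero
      (mul_ne_zero (Complex.exp_ne_zero _) hd))

lemma TH_theta3 (ℓ μ : ℝ) (hℓ : 0 < ℓ) (z : ℂ) : TH ℓ (z - zmu ℓ μ) =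
    -I * (cexp (Real.pi * I * tau ℓ / 4 + Real.pi * I * ((0 - zmu ℓ μ) / ℓ)) *
      cexp (Real.pi * I * z / ℓ) * theta3 (tau ℓ) (z / ℓ + μ)) := by
  have h0 : (ℓ : ℂ) ≠ 0 := by exact_mod_cast hℓ.ne'
  rw [TH, theta1_eq, theta3_eq, ← Complex.exp_add]
  have a1 : (Real.pi : ℂ) * I * tau ℓ / 4 + Real.pi * I * ((z - zmu ℓ μ) / ℓ) =
      Real.pi * I * tau ℓ / 4 + Real.pi * I * ((0 - zmu ℓ μ) / ℓ) + Real.pi * I * z / ℓ := by ring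
  have a2 : (z - zmu ℓ μ) / ℓ + 1 / 2 + tau ℓ / 2 = z / ℓ + μ := by
    rw [zmu, tau]
    field_simp
    ring
  rw [a1, a2]

lemma zmu_notMem (ℓ μ : ℝ) (hℓ : 0 < ℓ) (hμ : theta3 (tau ℓ) (μ : ℂ) ≠ 0) :
    TH ℓ (-zmu ℓ μ) ≠ 0 := by
  rw [← zero_sub, TH_theta3 ℓ μ hℓ, zero_div, zero_add]
  simp [hμ]

lemma fmu_Phi (ℓ μ : ℝ) (hℓ : 0 < ℓ) (hμ : theta3 (tau ℓ) (μ : ℂ) ≠ 0) (z : ℂ) :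
    fmu ℓ μ z = 2 / (Real.pi * I) * cexp (-(Real.pi * I / ℓ * z)) * Phi (TH ℓ) (zmu ℓ μ) z := by
  have h0 : (ℓ : ℂ) ≠ 0 := by exact_mod_cast hℓ.ne'
  rw [fmu, gmu, Phi, TH_deriv ℓ hℓ, TH_theta3 ℓ μ hℓ z, ← zero_sub (zmu ℓ μ),
    TH_theta3 ℓ μ hℓ 0]
  rw [show TH ℓ z = theta1 (tau ℓ) (z / ℓ) from rfl]
  rw [zero_div, zero_add, mul_zero, zero_div, Complex.exp_zero, mul_one, Complex.exp_neg,
    show (Real.pi : ℂ) * I / ℓ * z = Real.pi * I * z / ℓ by ring]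
  have e1 := Complex.exp_ne_zero (Real.pi * I * z / ℓ)
  have e2 := Complex.exp_ne_zero (Real.pi * I * tau ℓ / 4 + Real.pi * I * ((0 - zmu ℓ μ) / ℓ))
  generalize cexp (Real.pi * I * z / ℓ) = E1 at *
  generalize cexp (Real.pi * I * tau ℓ / 4 + Real.pi * I * ((0 - zmu ℓ μ) / ℓ)) = E2 at *
  generalize theta3 (tau ℓ) (z / ℓ + μ) = t3 at *
  generalize theta3 (tau ℓ) μ = t30 at *
  generalize theta1 (tau ℓ) (z / ℓ) = t1 at *
  generalize deriv (theta1 (tau ℓ)) 0 = d at *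
  have hI := I_ne_zero
  have hp : (Real.pi : ℂ) ≠ 0 := by exact_mod_cast Real.pi_ne_zero
  by_cases ht : t1 = 0
  · subst ht; simp
  field_simp

lemma wp_eq (ℓ : ℝ) (hℓ : 0 < ℓ) :
    wp (ℓ : ℂ) (2 * Real.pi * Complex.I) = (pairL ℓ hℓ).weierstrassP := by
  ext z
  set L := pairL ℓ hℓ with hL
  have h1 := L.hasSum_weierstrassP z
  have h2 := (L.latticeEquivProd.symm.toEquiv.hasSum_iff).2 h1
  let F : ℤ × ℤ → ℂ := fun p => 1 / (z - ((p.1 : ℂ) * ℓ + (p.2 : ℂ) * (2 * Real.pi * I))) ^ 2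
      - 1 / ((p.1 : ℂ) * ℓ + (p.2 : ℂ) * (2 * Real.pi * I)) ^ 2
  have h3 : HasSum F (L.weierstrassP z) := by
    convert h2 using 1
    ext p
    have := L.latticeEquiv_symm_apply p
    simp only [Function.comp, LinearEquiv.coe_toEquiv, F]
    rw [this]
    rfl
  have h4 := (h3.summable.tsum_subtype_add_tsum_subtype_compl {0})
  rw [h3.tsum_eq] at h4
  rw [← h4, wp]
  congr 1
  · rw [tsum_singleton]
    simp [F]

lemma final (ℓ μ : ℝ) (hℓ : 0 < ℓ)
    (hμ : theta3 (tau ℓ) (μ : ℂ) ≠ 0) (x y : ℂ) (hx : x ∉ (pairL ℓ hℓ).lattice)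
    (hy : y ∉ (pairL ℓ hℓ).lattice) (hxy : x + y ∉ (pairL ℓ hℓ).lattice) :
    fmu ℓ μ x * fmu ℓ μ y * fmu ℓ μ (-x - y) + fmu ℓ μ (-x) * fmu ℓ μ (-y) * fmu ℓ μ (x + y)
      = Complex.I * (2 / (Real.pi : ℂ)) ^ 3
          * deriv (wp (ℓ : ℂ) (2 * Real.pi * Complex.I)) (zmu ℓ μ) := by
  have hT := TH_like ℓ μ hℓ hμ
  have ha : zmu ℓ μ ∉ (pairL ℓ hℓ).lattice := fun hm =>
    zmu_notMem ℓ μ hℓ hμ ((hT.zero _).2 (neg_mem hm))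
  have key := TT_eq hT ha hx hy hxy
  rw [wp_eq ℓ hℓ, PeriodPair.deriv_weierstrassP, ← key, TT]
  simp only [fmu_Phi ℓ μ hℓ hμ]
  have c : (2 / ((Real.pi : ℂ) * I)) ^ 3 = I * (2 / (Real.pi : ℂ)) ^ 3 := by
    rw [show (2 / ((Real.pi : ℂ) * I)) = -I * (2 / Real.pi) by
      rw [← div_div, Complex.div_I]; ring, mul_pow, neg_pow, I_pow_three]
    ring
  set b : ℂ := Real.pi * I / ℓ
  have e1 : cexp (-(b * x)) * cexp (-(b * y)) * cexp (-(b * (-x - y))) = 1 := by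
    rw [← Complex.exp_add, ← Complex.exp_add, ← Complex.exp_zero]; ring_nf
  have e2 : cexp (-(b * -x)) * cexp (-(b * -y)) * cexp (-(b * (x + y))) = 1 := by
    rw [← Complex.exp_add, ← Complex.exp_add, ← Complex.exp_zero]; ring_nf
  rw [← c]
  linear_combination (2 / ((Real.pi : ℂ) * I)) ^ 3 *
    (Phi (TH ℓ) (zmu ℓ μ) x * Phi (TH ℓ) (zmu ℓ μ) y * Phi (TH ℓ) (zmu ℓ μ) (-x - y)) * e1 +
    (2 / ((Real.pi : ℂ) * I)) ^ 3 *
    (Phi (TH ℓ) (zmu ℓ μ) (-x) * Phi (TH ℓ) (zmu ℓ μ) (-y) * Phi (TH ℓ) (zmu ℓ μ) (x + y)) * e2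


/-- the symmetrized three-point cycle product of `f_μ` is the constant
`i·(2/π)³·℘′(z_μ;Λ_ℓ)`. -/
theorem stmt6 (ℓ μ : ℝ) (hℓ : 0 < ℓ)
    (hμ : theta3 (tau ℓ) (μ : ℂ) ≠ 0)
    (z₁ z₂ z₃ : ℂ)
    (hz : ∀ j k : Fin 3, j ≠ k →
      ![z₁, z₂, z₃] j - ![z₁, z₂, z₃] k ∉ lat (ℓ : ℂ) (2 * Real.pi * Complex.I)) :
    fmu ℓ μ (z₂ - z₁) * fmu ℓ μ (z₃ - z₂) * fmu ℓ μ (z₁ - z₃)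
      + fmu ℓ μ (z₁ - z₂) * fmu ℓ μ (z₂ - z₃) * fmu ℓ μ (z₃ - z₁)
      = Complex.I * (2 / (Real.pi : ℂ)) ^ 3
          * deriv (wp (ℓ : ℂ) (2 * Real.pi * Complex.I)) (zmu ℓ μ) := by
  have h10 := hz 1 0 (by decide)
  have h21 := hz 2 1 (by decide)
  have h20 := hz 2 0 (by decide)
  rw [lat_iff ℓ hℓ] at h10 h21 h20
  have h20' : (z₂ - z₁) + (z₃ - z₂) ∉ (pairL ℓ hℓ).lattice := by
    rw [show (z₂ - z₁) + (z₃ - z₂) = z₃ - z₁ by ring]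
    exact h20
  have := final ℓ μ hℓ hμ (z₂ - z₁) (z₃ - z₂) h10 h21 h20'
  rw [← this]
  ring_nf
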